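/- The fourth derivative of F satisfies F⁽⁴⁾(λ) = cosh λ/(π² sinh³λ) for every λ > 0. -/

import Mathlib

open MeasureTheory

/-- `F(λ) = -(1/(2π²)) ∫_λ^∞ log(1 - e^{-2s}) ds`. -/
noncomputable def F (lam : ℝ) : ℝ :=
  -(1 / (2 * Real.pi ^ 2)) * ∫ s in Set.Ioi lam, Real.log (1 - Real.exp (-2 * s))

open Filter Topology in
theorem isBigO_log_one_sub_exp :
    (fun s : ℝ => Real.log (1 - Real.exp (-2 * s))) =O[atTop] fun s => Real.exp (-2 * s) := by
  have hd : HasDerivAt (fun x : ℝ => Real.log (1 - x)) (-1 / (1 - 0)) 0 :=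
    ((hasDerivAt_id (0 : ℝ)).const_sub 1).log (by norm_num)
  have ht : Tendsto (fun s : ℝ => Real.exp (-2 * s)) atTop (𝓝 0) :=
    Real.tendsto_exp_atBot.comp (tendsto_id.const_mul_atTop_of_neg (by norm_num))
  simpa [Function.comp_def] using hd.isBigO_sub.comp_tendsto ht

theorem one_sub_exp_pos {s : ℝ} (hs : 0 < s) : 0 < 1 - Real.exp (-2 * s) :=
  sub_pos.2 (Real.exp_lt_one_iff.2 (by linarith))

theorem continuousOn_log_one_sub_exp :
    ContinuousOn (fun s : ℝ => Real.log (1 - Real.exp (-2 * s))) (Set.Ioi 0) :=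
  ContinuousOn.log (by fun_prop) fun _ hs => (one_sub_exp_pos hs).ne'

theorem integrableOn_log_one_sub_exp {a : ℝ} (ha : 0 < a) :
    IntegrableOn (fun s : ℝ => Real.log (1 - Real.exp (-2 * s))) (Set.Ioi a) :=
  integrable_of_isBigO_exp_neg two_pos
    (continuousOn_log_one_sub_exp.mono fun _ hs => lt_of_lt_of_le ha hs)
    isBigO_log_one_sub_exp

/-- The fundamental theorem of calculus for the lower endpoint of an integral over `(x, ∞)`. -/
theorem hasDerivAt_integral_Ioi {f : ℝ → ℝ} {a x : ℝ} (hax : a < x)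
    (hf : IntegrableOn f (Set.Ioi a)) (hc : ContinuousOn f (Set.Ioi a)) :
    HasDerivAt (fun y => ∫ s in Set.Ioi y, f s) (-f x) x := by
  have hint : ∀ y, a < y → IntervalIntegrable f volume a y := fun y hy =>
    (intervalIntegrable_iff_integrableOn_Ioc_of_le hy.le).2
      (hf.mono_set Set.Ioc_subset_Ioi_self)
  have hd : HasDerivAt (fun y => ∫ s in a..y, f s) (f x) x :=
    intervalIntegral.integral_hasDerivAt_right (hint x hax)
      (hc.stronglyMeasurableAtFilter isOpen_Ioi x hax)
      (hc.continuousAt (Ioi_mem_nhds hax))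
  refine (hd.const_sub (∫ s in Set.Ioi a, f s)).congr_of_eventuallyEq ?_
  filter_upwards [Ioi_mem_nhds hax] with y hy
  have := intervalIntegral.integral_interval_add_Ioi hf (hf.mono_set (Set.Ioi_subset_Ioi hy.le))
  linarith

theorem iteratedDeriv_succ_eq_of_pos {f g : ℝ → ℝ} {n : ℕ} {g' x : ℝ}
    (h : ∀ y, 0 < y → iteratedDeriv n f y = g y) (hx : 0 < x) (hg : HasDerivAt g g' x) :
    iteratedDeriv (n + 1) f x = g' := by
  rw [iteratedDeriv_succ]
  refine (hg.congr_of_eventuallyEq ?_).deriv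
  filter_upwards [Ioi_mem_nhds hx] with y hy using h y hy

theorem hasDerivAt_F {x : ℝ} (hx : 0 < x) :
    HasDerivAt F (1 / (2 * Real.pi ^ 2) * Real.log (1 - Real.exp (-2 * x))) x := by
  have h := (hasDerivAt_integral_Ioi (half_lt_self hx)
    (integrableOn_log_one_sub_exp (half_pos hx))
    (continuousOn_log_one_sub_exp.mono (Set.Ioi_subset_Ioi (half_pos hx).le))).const_mul
      (-(1 / (2 * Real.pi ^ 2)))
  exact h.congr_deriv (by ring)

theorem hasDerivAt_log_one_sub_exp {x : ℝ} (hx : 0 < x) :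
    HasDerivAt (fun s : ℝ => Real.log (1 - Real.exp (-2 * s)))
      (Real.cosh x / Real.sinh x - 1) x := by
  have h := ((((hasDerivAt_id x).const_mul (-2)).exp).const_sub 1).log (one_sub_exp_pos hx).ne'
  refine h.congr_deriv ?_
  have h1 : Real.sinh x ≠ 0 := (Real.sinh_pos_iff.2 hx).ne'
  have h2 := (one_sub_exp_pos hx).ne'
  have h3 : Real.exp (-2 * x) = Real.exp (-x) * Real.exp (-x) := by
    rw [← Real.exp_add]; ring_nf
  have h4 : Real.exp x * Real.exp (-x) = 1 := by rw [← Real.exp_add]; simp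
  simp only [id, mul_one]
  rw [div_sub_one h1, Real.cosh_sub_sinh, div_eq_div_iff h2 h1, Real.sinh_eq, h3]
  linear_combination Real.exp (-x) * h4

theorem hasDerivAt_coth {x : ℝ} (hx : 0 < x) :
    HasDerivAt (fun s : ℝ => Real.cosh s / Real.sinh s) (-1 / Real.sinh x ^ 2) x := by
  have h := (Real.hasDerivAt_cosh x).div (Real.hasDerivAt_sinh x) (Real.sinh_pos_iff.2 hx).ne'
  refine h.congr_deriv ?_
  congr 1
  linear_combination -Real.cosh_sq x

theorem hasDerivAt_neg_one_div_sinh_sq {x : ℝ} (hx : 0 < x) :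
    HasDerivAt (fun s : ℝ => -1 / Real.sinh s ^ 2) (2 * Real.cosh x / Real.sinh x ^ 3) x := by
  have h1 : Real.sinh x ≠ 0 := (Real.sinh_pos_iff.2 hx).ne'
  have h := (hasDerivAt_const x (-1 : ℝ)).div ((Real.hasDerivAt_sinh x).pow 2) (pow_ne_zero 2 h1)
  refine h.congr_deriv ?_
  simp only [Pi.pow_apply]
  field_simp
  norm_num
  ring

/-- The fourth derivative of `F` satisfies `F⁽⁴⁾(λ) = cosh λ/(π² sinh³λ)` for every `λ > 0`. -/
theorem F_fourth_deriv (lam : ℝ) (hlam : 0 < lam) :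
    iteratedDeriv 4 F lam = Real.cosh lam / (Real.pi ^ 2 * Real.sinh lam ^ 3) := by
  have h1 := fun y (hy : 0 < y) => iteratedDeriv_succ_eq_of_pos (n := 0)
    (fun z _ => congrFun (iteratedDeriv_zero (f := F)) z) hy (hasDerivAt_F hy)
  have h2 := fun y (hy : 0 < y) => iteratedDeriv_succ_eq_of_pos h1 hy
    ((hasDerivAt_log_one_sub_exp hy).const_mul _)
  have h3 := fun y (hy : 0 < y) => iteratedDeriv_succ_eq_of_pos h2 hy
    (((hasDerivAt_coth hy).sub_const 1).const_mul _)
  have h4 := iteratedDeriv_succ_eq_of_pos h3 hlam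
    ((hasDerivAt_neg_one_div_sinh_sq hlam).const_mul _)
  rw [h4]
  have hs : Real.sinh lam ≠ 0 := (Real.sinh_pos_iff.2 hlam).ne'
  have hp := Real.pi_ne_zero
  field_simp
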